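/- Let (Ω, 𝔉, P) be a probability space with a filtration 𝔉₀ ⊆ 𝔉₁ ⊆ … ⊆ 𝔉_N ⊆ 𝔉, and let m₁,…,m_N be real random variables such that m_i is 𝔉_i-measurable for each i. Let κ > 0, η > 0, c > 0, and suppose that for every s ∈ ℝ with |s| ≤ η/κ and every i = 1,…,N, exp(s·m_i) is integrable and 𝔼[exp(s·m_i) | 𝔉_{i−1}] ≤ exp(c·s²·κ²) almost surely, and that the same conditional bound holds with m_i replaced by −m_i. Then for every ε > 0, P( (1/N)·|Σ_{i=1}^N m_i| ≥ ε ) ≤ 2·exp( −min( N·ε²/(4c·κ²), η·N·ε/(2κ) ) ). -/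

import Mathlib

open MeasureTheory

lemma aux_step {Ω : Type} (F : MeasurableSpace Ω) {m0 : MeasurableSpace Ω} (P : Measure Ω) [IsProbabilityMeasure P]
    (hF : F ≤ m0) (f : Ω → ENNReal) (hf : Measurable[F] f)
    (g : Ω → ℝ) (hg0 : ∀ ω, 0 ≤ g ω) (hgm : Measurable g) (hg : Integrable g P) (C : ℝ)
    (hC : ∀ᵐ ω ∂P, (P[g | F]) ω ≤ C) :
    ∫⁻ ω, f ω * ENNReal.ofReal (g ω) ∂P ≤ ENNReal.ofReal C * ∫⁻ ω, f ω ∂P := by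
  have hle : (P.withDensity (fun ω => ENNReal.ofReal (g ω))).trim hF
      ≤ ENNReal.ofReal C • P.trim hF := by
    refine Measure.le_iff.2 fun A hA => ?_
    rw [trim_measurableSet_eq hF hA, Measure.smul_apply, trim_measurableSet_eq hF hA,
      withDensity_apply _ (hF _ hA),
      ← ofReal_integral_eq_lintegral_ofReal hg.integrableOn (Filter.Eventually.of_forall hg0),
      ← setIntegral_condExp hF hg hA]
    have h1 : ∫ ω in A, (P[g | F]) ω ∂P ≤ ∫ ω in A, C ∂P :=
      integral_mono_ae integrable_condExp.integrableOn (integrable_const C)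
        (ae_restrict_of_ae hC)
    have hC0 : 0 ≤ C := by
      have h2 : ∀ᵐ ω ∂P, 0 ≤ (P[g | F]) ω :=
        condExp_nonneg (Filter.Eventually.of_forall hg0)
      obtain ⟨ω, h3, h4⟩ := (h2.and hC).exists
      exact h3.trans h4
    refine (ENNReal.ofReal_le_ofReal h1).trans ?_
    rw [setIntegral_const, smul_eq_mul, ENNReal.ofReal_mul measureReal_nonneg,
      ofReal_measureReal, smul_eq_mul, mul_comm]
  calc ∫⁻ ω, f ω * ENNReal.ofReal (g ω) ∂P
      = ∫⁻ ω, f ω ∂(P.withDensity (fun ω => ENNReal.ofReal (g ω))) := by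
        rw [lintegral_withDensity_eq_lintegral_mul _ hgm.ennreal_ofReal (hf.mono hF le_rfl)]
        simp [mul_comm]
    _ = ∫⁻ ω, f ω ∂((P.withDensity (fun ω => ENNReal.ofReal (g ω))).trim hF) :=
        (lintegral_trim hF hf).symm
    _ ≤ ∫⁻ ω, f ω ∂(ENNReal.ofReal C • P.trim hF) := lintegral_mono' hle le_rfl
    _ = ENNReal.ofReal C * ∫⁻ ω, f ω ∂P := by
        rw [lintegral_smul_measure, lintegral_trim hF hf, smul_eq_mul]

lemma aux_mgf {Ω : Type} {m0 : MeasurableSpace Ω} (P : Measure Ω) [IsProbabilityMeasure P]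
    (K : ℝ) (N : ℕ) : ∀ (F : Fin (N + 1) → MeasurableSpace Ω) (_ : Monotone F)
    (_ : ∀ i, F i ≤ m0) (X : Fin N → Ω → ℝ) (_ : ∀ i : Fin N, Measurable[F i.succ] (X i))
    (_ : ∀ i, Integrable (fun ω => Real.exp (X i ω)) P)
    (_ : ∀ i : Fin N, ∀ᵐ ω ∂P, (P[fun ω' => Real.exp (X i ω') | F i.castSucc]) ω ≤ Real.exp K),
    ∫⁻ ω, ENNReal.ofReal (Real.exp (∑ i, X i ω)) ∂P ≤ ENNReal.ofReal (Real.exp (N * K)) := by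
  induction N with
  | zero => intros; simp
  | succ n ih =>
    intro F hF hle X hX hint hc
    have ih' := ih (fun i => F i.castSucc) (fun i j h => hF (by simpa using h))
      (fun i => hle _) (fun i => X i.castSucc) (fun i => hX i.castSucc)
      (fun i => hint _) (fun i => hc i.castSucc)
    have hm : Measurable[F (Fin.last n).castSucc]
        (fun ω => ENNReal.ofReal (Real.exp (∑ i : Fin n, X i.castSucc ω))) := by
      refine ENNReal.measurable_ofReal.comp (Real.measurable_exp.comp ?_)
      refine Finset.measurable_fun_sum _ fun i _ => ?_
      refine (hX i.castSucc).mono (hF ?_) le_rfl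
      rw [Fin.le_def]; simp
    have h := aux_step _ P (hle _) _ hm (fun ω => Real.exp (X (Fin.last n) ω))
      (fun ω => (Real.exp_pos _).le) (((hX _).mono (hle _) le_rfl).exp) (hint _) _
      (hc (Fin.last n))
    calc ∫⁻ ω, ENNReal.ofReal (Real.exp (∑ i, X i ω)) ∂P
        = ∫⁻ ω, ENNReal.ofReal (Real.exp (∑ i : Fin n, X i.castSucc ω)) *
            ENNReal.ofReal (Real.exp (X (Fin.last n) ω)) ∂P := by
          congr 1; ext ω
          rw [Fin.sum_univ_castSucc, Real.exp_add, ENNReal.ofReal_mul (Real.exp_pos _).le]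
      _ ≤ _ := h
      _ ≤ ENNReal.ofReal (Real.exp K) * ENNReal.ofReal (Real.exp (n * K)) := by gcongr
      _ = _ := by
          rw [← ENNReal.ofReal_mul (Real.exp_pos _).le, ← Real.exp_add]
          congr 2; push_cast; ring

lemma aux_tail {Ω : Type} {m0 : MeasurableSpace Ω} (P : Measure Ω) [IsProbabilityMeasure P]
    (K : ℝ) (N : ℕ) (F : Fin (N + 1) → MeasurableSpace Ω) (hF : Monotone F)
    (hle : ∀ i, F i ≤ m0) (X : Fin N → Ω → ℝ) (hX : ∀ i : Fin N, Measurable[F i.succ] (X i))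
    (hint : ∀ i, Integrable (fun ω => Real.exp (X i ω)) P)
    (hc : ∀ i : Fin N, ∀ᵐ ω ∂P,
      (P[fun ω' => Real.exp (X i ω') | F i.castSucc]) ω ≤ Real.exp K) (t : ℝ) :
    P {ω | t ≤ ∑ i, X i ω} ≤ ENNReal.ofReal (Real.exp (N * K - t)) := by
  have h := aux_mgf P K N F hF hle X hX hint hc
  have hm : Measurable (fun ω => ENNReal.ofReal (Real.exp (∑ i, X i ω))) := by
    refine ENNReal.measurable_ofReal.comp (Real.measurable_exp.comp ?_)
    exact Finset.measurable_fun_sum _ fun i _ => (hX i).mono (hle _) le_rfl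
  have h2 := mul_meas_ge_le_lintegral hm (μ := P) (ENNReal.ofReal (Real.exp t))
  have hs : {ω | t ≤ ∑ i, X i ω} =
      {ω | ENNReal.ofReal (Real.exp t) ≤ ENNReal.ofReal (Real.exp (∑ i, X i ω))} := by
    ext ω
    simp [ENNReal.ofReal_le_ofReal_iff (Real.exp_pos _).le]
  rw [← hs] at h2
  have h3 := h2.trans h
  calc P {ω | t ≤ ∑ i, X i ω}
      = ENNReal.ofReal (Real.exp (-t)) *
          (ENNReal.ofReal (Real.exp t) * P {ω | t ≤ ∑ i, X i ω}) := by
        rw [← mul_assoc, ← ENNReal.ofReal_mul (Real.exp_pos _).le, ← Real.exp_add]; simp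
    _ ≤ ENNReal.ofReal (Real.exp (-t)) * ENNReal.ofReal (Real.exp (N * K)) := by gcongr
    _ = _ := by
        rw [← ENNReal.ofReal_mul (Real.exp_pos _).le, ← Real.exp_add]
        congr 2; ring

/-- Azuma–Bernstein concentration for sums of sub-exponential martingale difference
sequences: under two-sided conditional MGF bounds,
`P((1/N)|Σᵢ m_i| ≥ ε) ≤ 2·exp(−min(Nε²/(4cκ²), ηNε/(2κ)))`. -/
theorem statement16
    (Ω : Type) [MeasurableSpace Ω]
    (P : Measure Ω) [IsProbabilityMeasure P]
    (N : ℕ)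
    (𝔉 : Fin (N + 1) → MeasurableSpace Ω)
    (h𝔉_mono : Monotone 𝔉)
    (h𝔉_le : ∀ i, 𝔉 i ≤ ‹MeasurableSpace Ω›)
    (m : Fin N → Ω → ℝ)
    (hadapted : ∀ i : Fin N, Measurable[𝔉 i.succ] (m i))
    (κ η c : ℝ) (hκ : 0 < κ) (hη : 0 < η) (hc : 0 < c)
    (hint : ∀ (s : ℝ), |s| ≤ η / κ → ∀ i : Fin N,
      Integrable (fun ω => Real.exp (s * m i ω)) P)
    (hcond : ∀ (s : ℝ), |s| ≤ η / κ → ∀ i : Fin N,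
      ∀ᵐ ω ∂P,
        (P[fun ω' => Real.exp (s * m i ω') | 𝔉 i.castSucc]) ω ≤
          Real.exp (c * s ^ 2 * κ ^ 2))
    (hcond' : ∀ (s : ℝ), |s| ≤ η / κ → ∀ i : Fin N,
      ∀ᵐ ω ∂P,
        (P[fun ω' => Real.exp (s * (-(m i ω'))) | 𝔉 i.castSucc]) ω ≤
          Real.exp (c * s ^ 2 * κ ^ 2)) :
    ∀ ε : ℝ, 0 < ε →
      P {ω | ε ≤ (1 / (N : ℝ)) * |∑ i, m i ω|} ≤
        ENNReal.ofReal (2 * Real.exp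
          (-min ((N : ℝ) * ε ^ 2 / (4 * c * κ ^ 2)) (η * (N : ℝ) * ε / (2 * κ)))) := by
  intro ε hε
  rcases Nat.eq_zero_or_pos N with hN | hN
  · subst hN
    simp [not_le.2 hε]
  have hN' : (0 : ℝ) < N := by exact_mod_cast hN
  obtain ⟨s, hs⟩ : ∃ s, s = min (ε / (2 * c * κ ^ 2)) (η / κ) := ⟨_, rfl⟩
  have hs0 : 0 < s := by rw [hs]; exact lt_min (by positivity) (by positivity)
  have hs1 : s ≤ ε / (2 * c * κ ^ 2) := by rw [hs]; exact min_le_left _ _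
  have hs2 : |s| ≤ η / κ := by rw [abs_of_pos hs0, hs]; exact min_le_right _ _
  have hmin : min ((N : ℝ) * ε ^ 2 / (4 * c * κ ^ 2)) (η * (N : ℝ) * ε / (2 * κ))
      = N * ε / 2 * s := by
    rw [hs, mul_min_of_nonneg _ _ (by positivity)]
    congr 1 <;> field_simp <;> ring
  have hb : N * (c * s ^ 2 * κ ^ 2) - s * (N * ε) ≤ -(N * ε / 2 * s) := by
    rw [le_div_iff₀ (by positivity)] at hs1
    nlinarith [mul_le_mul_of_nonneg_left hs1 (mul_pos hN' hs0).le]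
  have t1 := aux_tail P (c * s ^ 2 * κ ^ 2) N 𝔉 h𝔉_mono h𝔉_le (fun i ω => s * m i ω)
    (fun i => (hadapted i).const_mul s) (hint s hs2) (hcond s hs2) (s * (N * ε))
  have t2 := aux_tail P (c * s ^ 2 * κ ^ 2) N 𝔉 h𝔉_mono h𝔉_le (fun i ω => s * (-(m i ω)))
    (fun i => (hadapted i).neg.const_mul s)
    (fun i => by simpa using hint (-s) (by simpa using hs2) i) (hcond' s hs2) (s * (N * ε))
  have hsub : {ω | ε ≤ (1 / (N : ℝ)) * |∑ i, m i ω|} ⊆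
      {ω | s * (N * ε) ≤ ∑ i, s * m i ω} ∪ {ω | s * (N * ε) ≤ ∑ i, s * (-(m i ω))} := by
    intro ω hω
    simp only [Set.mem_ofPred_eq, Set.mem_union, ← Finset.mul_sum, Finset.sum_neg_distrib] at hω ⊢
    rw [one_div, inv_mul_eq_div, le_div_iff₀ hN', le_abs] at hω
    rcases hω with h | h
    · left; exact mul_le_mul_of_nonneg_left (by linarith) hs0.le
    · right; exact mul_le_mul_of_nonneg_left (by linarith) hs0.le
  have hE := ENNReal.ofReal_le_ofReal (Real.exp_le_exp.2 hb)
  rw [hmin, two_mul, ENNReal.ofReal_add (Real.exp_pos _).le (Real.exp_pos _).le]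
  exact (measure_mono hsub).trans ((measure_union_le _ _).trans
    (add_le_add (t1.trans hE) (t2.trans hE)))
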